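/- For every fixed 0 ≤ p < 1, every θ > 0 and every t > 0, the zero-inflated Poisson variable is dominated in the convex order by the zero-inflated negative binomial variable of the first kind: Y(θ,p) ≤cx Z₁(t,θ,p). -/

import Mathlib

open MeasureTheory Filter Topology ProbabilityTheory

noncomputable section

/-- `ConvexOrder μ ν` means the distribution `μ` is dominated by `ν` in the convex order:
`∫ φ dμ ≤ ∫ φ dν` for every convex function `φ : ℝ → ℝ` for which both integrals are
well defined. -/
def ConvexOrder (μ ν : Measure ℝ) : Prop :=
  ∀ φ : ℝ → ℝ, ConvexOn ℝ Set.univ φ → Integrable φ μ → Integrable φ ν →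
    ∫ x, φ x ∂μ ≤ ∫ x, φ x ∂ν

/-- The discrete measure on `ℝ` supported on the nonnegative integers with weights `w k`. -/
def discreteMeasure (w : ℕ → ℝ) : Measure ℝ :=
  Measure.sum fun k => ENNReal.ofReal (w k) • Measure.dirac (k : ℝ)

/-- The Poisson probabilities with mean `θ`. -/
def poissonPMFReal (θ : ℝ) (k : ℕ) : ℝ := Real.exp (-θ) * θ ^ k / k.factorial

/-- The Poisson distribution with mean `θ`, as a measure on `ℝ`. -/
def poissonMeasure (θ : ℝ) : Measure ℝ := discreteMeasure (poissonPMFReal θ)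

/-- The binomial probabilities with parameters `m` and `q`. -/
def binomialPMFReal (m : ℕ) (q : ℝ) (k : ℕ) : ℝ :=
  (m.choose k) * q ^ k * (1 - q) ^ (m - k)

/-- The binomial distribution with parameters `m` and `q`, as a measure on `ℝ`. -/
def binomialMeasure (m : ℕ) (q : ℝ) : Measure ℝ := discreteMeasure (binomialPMFReal m q)

/-- The negative binomial probabilities: `P(Z(t,θ) = k) =
(Γ(k + 1/t)/(k! Γ(1/t))) (θt)^k / (1 + θt)^(k + 1/t)`; this distribution has mean `θ`. -/
def negBinomialPMFReal (t θ : ℝ) (k : ℕ) : ℝ :=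
  Real.Gamma (k + 1 / t) / (k.factorial * Real.Gamma (1 / t)) * (θ * t) ^ k /
    (1 + θ * t) ^ ((k : ℝ) + 1 / t)

/-- The negative binomial distribution `Z(t,θ)`, as a measure on `ℝ`. -/
def negBinomialMeasure (t θ : ℝ) : Measure ℝ := discreteMeasure (negBinomialPMFReal t θ)

/-- Zero inflation: the mixture of the point mass at `0` with weight `p` and `μ` with
weight `1 - p`. -/
def ziMeasure (p : ℝ) (μ : Measure ℝ) : Measure ℝ :=
  ENNReal.ofReal p • Measure.dirac (0 : ℝ) + ENNReal.ofReal (1 - p) • μ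

/-- The zero-inflated Poisson distribution `Y(θ,p)`: mixture of the point mass at `0` with
weight `p` and the Poisson distribution with mean `θ/(1-p)` with weight `1-p`. -/
def ZIP (θ p : ℝ) : Measure ℝ := ziMeasure p (poissonMeasure (θ / (1 - p)))

/-- The zero-inflated binomial distribution `X(m,θ,p)`: mixture of the point mass at `0` with
weight `p` and the binomial distribution with parameters `m` and `θ/(m(1-p))` with
weight `1-p`. -/
def ZIB (m : ℕ) (θ p : ℝ) : Measure ℝ :=
  ziMeasure p (binomialMeasure m (θ / (m * (1 - p))))

/-- The zero-inflated negative binomial distribution of the first kind `Z₁(t,θ,p)`: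
mixture of the point mass at `0` with weight `p` and `Z(t(1-p), θ/(1-p))` with weight `1-p`. -/
def ZINB₁ (t θ p : ℝ) : Measure ℝ :=
  ziMeasure p (negBinomialMeasure (t * (1 - p)) (θ / (1 - p)))

/-- The zero-inflated negative binomial distribution of the second kind `Z₂(t,θ,p)`:
mixture of the point mass at `0` with weight `p` and `Z(t, θ/(1-p))` with weight `1-p`. -/
def ZINB₂ (t θ p : ℝ) : Measure ℝ :=
  ziMeasure p (negBinomialMeasure t (θ / (1 - p)))

/-- The probability mass function of the zero-inflated negative binomial
distribution `Z₂(t,θ,p)`. -/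
def zinb2PMFReal (t θ p : ℝ) (k : ℕ) : ℝ :=
  (if k = 0 then p else 0) + (1 - p) * negBinomialPMFReal t (θ / (1 - p)) k

/-- The expected value of the maximum of `k` independent copies of a random variable with
distribution `μ`. -/
def expMax (μ : Measure ℝ) (k : ℕ) : ℝ :=
  ∫ x : Fin k → ℝ, (⨆ i, x i) ∂(Measure.pi fun _ => μ)

/-- The expected value of the minimum of `k` independent copies of a random variable with
distribution `μ`. -/
def expMin (μ : Measure ℝ) (k : ℕ) : ℝ :=
  ∫ x : Fin k → ℝ, (⨅ i, x i) ∂(Measure.pi fun _ => μ)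

/-- The modified Bessel function of the first kind of integer order `n`. -/
def besselI (n : ℕ) (x : ℝ) : ℝ :=
  ∑' j : ℕ, (x / 2) ^ (2 * j + n) / (j.factorial * (j + n).factorial)

/-- `M₂ θ`: the expected value of the maximum of two independent Poisson random variables
with mean `θ`. -/
def M₂ (x : ℝ) : ℝ := x + x * Real.exp (-2 * x) * (besselI 0 (2 * x) + besselI 1 (2 * x))

/-- The discrepancy `Δ₂:₂(θ,p) = 2pθ + (1-p)² M₂(θ/(1-p)) − M₂(θ)`. -/
def Δdisc (θ p : ℝ) : ℝ := 2 * p * θ + (1 - p) ^ 2 * M₂ (θ / (1 - p)) - M₂ θ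

/-- The asymptotic variance `σ²(θ)` of `√n Δ₂:₂` under the Poisson null hypothesis. -/
def σsq (θ : ℝ) : ℝ :=
  θ ^ 2 * (1 - Real.exp (-2 * θ) *
      ((1 + θ) * besselI 0 (2 * θ) - besselI 1 (2 * θ) + θ * besselI 2 (2 * θ))) ^ 2 /
    (Real.exp θ - 1 - θ)


/-- If `∑ d k = 0`, `∑ k * d k = 0` and `d` is negative exactly on an order-connected set, then
`∑ φ k * d k` is nonnegative for every convex `φ`. -/
lemma hasSum_mul_nonneg_of_convexOn {d : ℕ → ℝ} (hd : HasSum d 0)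
    (hkd : HasSum (fun k : ℕ => (k : ℝ) * d k) 0)
    (hconn : ∀ i j l, i ≤ j → j ≤ l → d i < 0 → d l < 0 → d j < 0)
    {φ : ℝ → ℝ} (hφ : ConvexOn ℝ Set.univ φ) {s : ℝ}
    (hs : HasSum (fun k : ℕ => φ k * d k) s) : 0 ≤ s := by
  have affine (a b : ℝ) : HasSum (fun k : ℕ => (a * k + b) * d k) 0 := by
    have h := (hkd.mul_left a).add (hd.mul_left b)
    simp only [mul_zero, add_zero] at h
    refine h.congr_fun fun k => ?_
    ring
  by_cases hex : ∃ k, d k < 0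
  swap
  · push Not at hex
    have h0 := (hasSum_zero_iff_of_nonneg (f := d) hex).1 hd
    simp only [h0, Pi.zero_apply, mul_zero] at hs
    exact (hs.unique hasSum_zero).ge
  classical
  set m := Nat.find hex with hm
  have hdm : d m < 0 := Nat.find_spec hex
  have hlt : ∀ k < m, 0 ≤ d k := fun k hk => not_lt.1 (Nat.find_min hex hk)
  by_cases hbdd : ∃ M, ∀ k, d k < 0 → k ≤ M
  swap
  · push Not at hbdd
    have hneg : ∀ k, m ≤ k → d k < 0 := fun k hk => by
      obtain ⟨l, hl, hkl⟩ := hbdd k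
      exact hconn m k l hk hkl.le hdm hl
    have h0 := (hasSum_zero_iff_of_nonneg (f := fun k : ℕ => (-1 * (k : ℝ) + m) * d k)
      (fun k => by
        rcases lt_or_ge k m with h | h
        · have : (k : ℝ) < m := by exact_mod_cast h
          exact mul_nonneg (by linarith) (hlt k h)
        · have : (m : ℝ) ≤ k := by exact_mod_cast h
          exact mul_nonneg_of_nonpos_of_nonpos (by linarith) (hneg k h).le)).1 (affine _ _)
    have h1 := congrFun h0 (m + 1)
    have h2 := hneg (m + 1) (by omega)
    simp only [Pi.zero_apply, Nat.cast_add, Nat.cast_one] at h1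
    linarith
  set M := Nat.find hbdd with hM
  have hgt : ∀ k, d k < 0 → k ≤ M := Nat.find_spec hbdd
  have hdM : d M < 0 := by
    by_contra hcon
    have hmM := hgt m hdm
    have hne : m ≠ M := fun h => hcon (h ▸ hdm)
    refine Nat.find_min hbdd (m := M - 1) (by omega) fun k hk => ?_
    have h1 := hgt k hk
    have h2 : k ≠ M := fun h => hcon (h ▸ hk)
    omega
  have hmM : (m : ℝ) ≤ M := by exact_mod_cast hgt m hdm
  -- subtract the chord of `φ` between `m - 1/2` and `M + 1/2`
  set x : ℝ := m - 1 / 2 with hx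
  set y : ℝ := M + 1 / 2 with hy
  have hxy : 0 < y - x := by linarith
  set a := (φ y - φ x) / (y - x) with ha
  have hay : a * (y - x) = φ y - φ x := by rw [ha]; field_simp
  have hsum := hs.sub (affine a (φ x - a * x))
  rw [sub_zero] at hsum
  refine hsum.nonneg fun k => ?_
  rw [← sub_mul]
  have key := fun u v w => hφ.secant_mono_aux1 (x := u) (y := v) (z := w)
    (Set.mem_univ _) (Set.mem_univ _)
  rcases lt_or_ge k m with h | h
  · have hk : (k : ℝ) + 1 ≤ m := by exact_mod_cast h
    refine mul_nonneg ?_ (hlt k h)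
    have := key k x y (by linarith) (by linarith)
    refine nonneg_of_mul_nonneg_right (a := y - x) ?_ hxy
    linear_combination this + ((k : ℝ) - x) * hay
  rcases le_or_gt k M with h' | h'
  · have hk : (m : ℝ) ≤ k := by exact_mod_cast h
    have hk' : (k : ℝ) ≤ M := by exact_mod_cast h'
    refine mul_nonneg_of_nonpos_of_nonpos ?_ (hconn m k M h h' hdm hdM).le
    have := key x k y (by linarith) (by linarith)
    refine nonpos_of_mul_nonpos_right (a := y - x) ?_ hxy
    linear_combination this - ((k : ℝ) - x) * hay
  · have hk : (M : ℝ) + 1 ≤ k := by exact_mod_cast h'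
    refine mul_nonneg ?_ (not_lt.1 fun h => absurd (hgt k h) (by omega))
    have := key x y k (by linarith) (by linarith)
    refine nonneg_of_mul_nonneg_right (a := y - x) ?_ hxy
    linear_combination this + ((k : ℝ) - x) * hay

/-- The Poisson probabilities sum to one. -/
lemma hasSum_poissonPMFReal (θ : ℝ) : HasSum (_root_.poissonPMFReal θ) 1 := by
  have h := (NormedSpace.expSeries_div_hasSum_exp (θ : ℝ)).mul_left (Real.exp (-θ))
  rw [← Real.exp_eq_exp_ℝ, ← Real.exp_add, neg_add_cancel, Real.exp_zero] at h
  refine h.congr_fun fun k => ?_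
  simp only [_root_.poissonPMFReal, mul_div_assoc]

/-- The Poisson distribution with parameter `θ` has mean `θ`. -/
lemma hasSum_mul_poissonPMFReal (θ : ℝ) :
    HasSum (fun k : ℕ => (k : ℝ) * _root_.poissonPMFReal θ k) θ := by
  rw [← hasSum_nat_add_iff' 1]
  have h := (hasSum_poissonPMFReal θ).mul_left θ
  simp only [Finset.sum_range_one, Nat.cast_zero, zero_mul, sub_zero]
  rw [mul_one] at h
  refine h.congr_fun fun k => ?_
  simp only [_root_.poissonPMFReal, Nat.factorial_succ]
  push_cast
  field_simp
  ring

lemma poissonPMFReal_pos {θ : ℝ} (hθ : 0 < θ) (k : ℕ) : 0 < _root_.poissonPMFReal θ k := by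
  unfold _root_.poissonPMFReal
  positivity

lemma poissonPMFReal_succ (θ : ℝ) (k : ℕ) :
    _root_.poissonPMFReal θ (k + 1) = _root_.poissonPMFReal θ k * (θ / (k + 1)) := by
  simp only [_root_.poissonPMFReal, Nat.factorial_succ]
  push_cast
  field_simp
  ring

lemma negBinomialPMFReal_pos {t θ : ℝ} (ht : 0 < t) (hθ : 0 < θ) (k : ℕ) :
    0 < negBinomialPMFReal t θ k := by
  have h1 : 0 < Real.Gamma (k + 1 / t) := Real.Gamma_pos_of_pos (by positivity)
  have h2 : 0 < Real.Gamma (1 / t) := Real.Gamma_pos_of_pos (by positivity)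
  unfold negBinomialPMFReal
  positivity

lemma negBinomialPMFReal_succ {t θ : ℝ} (ht : 0 < t) (hθ : 0 < θ) (k : ℕ) :
    negBinomialPMFReal t θ (k + 1) =
      negBinomialPMFReal t θ k * (θ / (k + 1) * ((1 + k * t) / (1 + θ * t))) := by
  have hG : Real.Gamma (1 / t) ≠ 0 := (Real.Gamma_pos_of_pos (by positivity)).ne'
  have hpos : 0 < 1 + θ * t := by positivity
  have hpow := (Real.rpow_pos_of_pos hpos ((k : ℝ) + 1 / t)).ne'
  have e1 : ((k + 1 : ℕ) : ℝ) + 1 / t = (k + 1 / t) + 1 := by push_cast; ring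
  have hk : (k : ℝ) + 1 / t ≠ 0 := by positivity
  simp only [negBinomialPMFReal, Nat.factorial_succ]
  rw [e1, Real.Gamma_add_one hk, Real.rpow_add_one hpos.ne']
  generalize Real.Gamma (k + 1 / t) = g
  generalize Real.Gamma (1 / t) = g' at *
  generalize (1 + θ * t) ^ ((k : ℝ) + 1 / t) = w at *
  push_cast
  field_simp
  ring

lemma Gamma_natCast_add {r : ℝ} (hr : 0 < r) (k : ℕ) :
    Real.Gamma (k + r) = Real.Gamma r * (ascPochhammer ℝ k).eval r := by
  induction k with
  | zero => simp
  | succ k ih =>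
    rw [ascPochhammer_succ_eval, ← mul_assoc, ← ih, Nat.cast_succ, add_right_comm,
      Real.Gamma_add_one (by positivity)]
    ring

/-- The binomial series with coefficients written in terms of the Gamma function. -/
lemma hasSum_Gamma_div_mul_pow {r x : ℝ} (hr : 0 < r) (hx : |x| < 1) :
    HasSum (fun k : ℕ => Real.Gamma (k + r) / (k.factorial * Real.Gamma r) * x ^ k)
      (1 / (1 - x) ^ r) := by
  have h := (Real.one_div_one_sub_rpow_hasFPowerSeriesOnBall_zero r).hasSum
    (y := x) (by
      rw [Metric.mem_eball, edist_zero_right, ← ofReal_norm, Real.norm_eq_abs]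
      exact ENNReal.ofReal_lt_one.2 hx)
  rw [zero_add] at h
  refine h.congr_fun fun k => ?_
  have hG : Real.Gamma r ≠ 0 := (Real.Gamma_pos_of_pos hr).ne'
  have hfac := Ring.factorial_nsmul_multichoose_eq_ascPochhammer r k
  rw [Polynomial.ascPochhammer_smeval_eq_eval, nsmul_eq_mul, Ring.multichoose_eq] at hfac
  rw [Gamma_natCast_add hr, ← hfac]
  have hk := Nat.cast_ne_zero (R := ℝ).2 k.factorial_ne_zero
  rw [FormalMultilinearSeries.ofScalars_apply_eq, smul_eq_mul, mul_left_comm,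
    mul_div_mul_left _ _ hk, mul_div_cancel_left₀ _ hG]

/-- The negative binomial probabilities sum to one. -/
lemma hasSum_negBinomialPMFReal {t θ : ℝ} (ht : 0 < t) (hθ : 0 < θ) :
    HasSum (negBinomialPMFReal t θ) 1 := by
  have hpos : 0 < 1 + θ * t := by positivity
  have hx : |θ * t / (1 + θ * t)| < 1 := by
    rw [abs_of_pos (by positivity), div_lt_one hpos]
    linarith
  have h := (hasSum_Gamma_div_mul_pow (r := 1 / t) (by positivity) hx).mul_left
    (1 / (1 + θ * t) ^ (1 / t))
  have e : 1 - θ * t / (1 + θ * t) = (1 + θ * t)⁻¹ := by field_simp; ring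
  have hw := (Real.rpow_pos_of_pos hpos (1 / t)).ne'
  have e2 : 1 / (1 + θ * t) ^ (1 / t) * (1 / (1 - θ * t / (1 + θ * t)) ^ (1 / t)) = 1 := by
    rw [e, Real.inv_rpow hpos.le]
    field_simp
  rw [e2] at h
  refine h.congr_fun fun k => ?_
  rw [negBinomialPMFReal, Real.rpow_add hpos, Real.rpow_natCast, div_pow]
  generalize (1 + θ * t) ^ (1 / t) = w at *
  field_simp

/-- The negative binomial distribution `Z(t,θ)` has mean `θ`. -/
lemma hasSum_mul_negBinomialPMFReal {t θ : ℝ} (ht : 0 < t) (hθ : 0 < θ) :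
    HasSum (fun k : ℕ => (k : ℝ) * negBinomialPMFReal t θ k) θ := by
  have hpos : 0 < 1 + θ * t := by positivity
  -- the summand shifted by one is a multiple of a negative binomial probability
  have hu : 0 < 1 / (1 / t + 1) := by positivity
  have hv : 0 < θ * (1 + t) := by positivity
  have h := (hasSum_negBinomialPMFReal hu hv).mul_left θ
  rw [← hasSum_nat_add_iff' 1]
  simp only [Finset.sum_range_one, Nat.cast_zero, zero_mul, sub_zero]
  rw [mul_one] at h
  refine h.congr_fun fun k => ?_
  have e : θ * (1 + t) * (1 / (1 / t + 1)) = θ * t := by field_simp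
  have e1 : ((k + 1 : ℕ) : ℝ) + 1 / t = k + (1 / t + 1) := by push_cast; ring
  have hG : Real.Gamma (1 / t) ≠ 0 := (Real.Gamma_pos_of_pos (by positivity)).ne'
  simp only [negBinomialPMFReal, Nat.factorial_succ]
  rw [e, one_div_one_div, e1, Real.Gamma_add_one (s := 1 / t) (by positivity)]
  have hw := (Real.rpow_pos_of_pos hpos ((k : ℝ) + (1 / t + 1))).ne'
  generalize Real.Gamma (k + (1 / t + 1)) = g
  generalize Real.Gamma (1 / t) = g' at *
  generalize (1 + θ * t) ^ ((k : ℝ) + (1 / t + 1)) = w at *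
  push_cast
  field_simp
  ring

/-- If the likelihood ratio `q / p` has nondecreasing successive quotients `c`, then
`{k | q k < p k}` is order-connected. -/
lemma sub_neg_of_monotone_ratio {p q c : ℕ → ℝ} (hp : ∀ k, 0 < p k) (hq : ∀ k, 0 < q k)
    (hc : Monotone c) (hstep : ∀ k, q (k + 1) / p (k + 1) = q k / p k * c k)
    (i j l : ℕ) (hij : i ≤ j) (hjl : j ≤ l) (hi : q i - p i < 0) (hl : q l - p l < 0) :
    q j - p j < 0 := by
  have hr : ∀ k, 0 < q k / p k := fun k => div_pos (hq k) (hp k)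
  have hiff : ∀ k, q k - p k < 0 ↔ q k / p k < 1 := fun k => by
    rw [div_lt_one (hp k), sub_neg]
  rw [hiff] at hi hl ⊢
  rcases le_or_gt (c j) 1 with hcj | hcj
  · refine lt_of_le_of_lt ?_ hi
    induction j, hij using Nat.le_induction with
    | base => exact le_rfl
    | succ n hn ih =>
      have hcn : c n ≤ 1 := (hc n.le_succ).trans hcj
      refine le_trans ?_ (ih (by omega) hcn)
      rw [hstep]
      exact mul_le_of_le_one_right (hr n).le hcn
  · refine lt_of_le_of_lt ?_ hl
    clear hl
    induction l, hjl using Nat.le_induction with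
    | base => exact le_rfl
    | succ n hn ih =>
      refine ih.trans ?_
      rw [hstep]
      exact le_mul_of_one_le_right (hr n).le (hcj.le.trans (hc hn))

lemma hasSum_integral_discreteMeasure {w : ℕ → ℝ} (hw : ∀ k, 0 ≤ w k) {φ : ℝ → ℝ}
    (hφ : Integrable φ (discreteMeasure w)) :
    HasSum (fun k : ℕ => φ k * w k) (∫ x, φ x ∂discreteMeasure w) := by
  have h := hasSum_integral_measure hφ
  simp only [integral_smul_measure, integral_dirac, ENNReal.toReal_ofReal (hw _),
    smul_eq_mul] at h
  exact h.congr_fun fun k => mul_comm _ _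

/-- The Poisson distribution is dominated in the convex order by every negative binomial
distribution with the same mean. -/
lemma poisson_convexOrder_negBinomial {t θ : ℝ} (ht : 0 < t) (hθ : 0 < θ) :
    ConvexOrder (_root_.poissonMeasure θ) (negBinomialMeasure t θ) := by
  intro φ hφ hp hq
  have hP := hasSum_integral_discreteMeasure (fun k => (poissonPMFReal_pos hθ k).le) hp
  have hQ := hasSum_integral_discreteMeasure (fun k => (negBinomialPMFReal_pos ht hθ k).le) hq
  have hpos : 0 < 1 + θ * t := by positivity
  have hd := (hasSum_negBinomialPMFReal ht hθ).sub (hasSum_poissonPMFReal θ)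
  have hkd := (hasSum_mul_negBinomialPMFReal ht hθ).sub (hasSum_mul_poissonPMFReal θ)
  have hs := hQ.sub hP
  simp only [← mul_sub, sub_self] at hd hkd hs
  refine sub_nonneg.1 (hasSum_mul_nonneg_of_convexOn hd hkd ?_ hφ hs)
  refine sub_neg_of_monotone_ratio (c := fun k : ℕ => (1 + k * t) / (1 + θ * t))
    (poissonPMFReal_pos hθ) (negBinomialPMFReal_pos ht hθ) ?_ fun k => ?_
  · intro a b hab
    have : (a : ℝ) ≤ b := by exact_mod_cast hab
    dsimp only
    gcongr
  · have h := (poissonPMFReal_pos hθ k).ne'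
    rw [negBinomialPMFReal_succ ht hθ, poissonPMFReal_succ]
    field_simp

/-- Zero inflation preserves the convex order. -/
lemma ConvexOrder.ziMeasure {μ ν : Measure ℝ} (h : ConvexOrder μ ν) {p : ℝ} (hp : p < 1) :
    ConvexOrder (ziMeasure p μ) (ziMeasure p ν) := by
  intro φ hφ h1 h2
  have hne : ENNReal.ofReal (1 - p) ≠ 0 := by simpa using hp
  unfold _root_.ziMeasure at *
  rw [integrable_add_measure] at h1 h2
  rw [integral_add_measure h1.1 h1.2, integral_add_measure h2.1 h2.2, integral_smul_measure,
    integral_smul_measure, integral_smul_measure]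
  have := h φ hφ ((integrable_smul_measure hne ENNReal.ofReal_ne_top).1 h1.2)
    ((integrable_smul_measure hne ENNReal.ofReal_ne_top).1 h2.2)
  gcongr

/-- For every fixed `0 ≤ p < 1`, every `θ > 0` and every `t > 0`, the
zero-inflated Poisson distribution is dominated in the convex order by the zero-inflated
negative binomial distribution of the first kind: `Y(θ,p) ≤cx Z₁(t,θ,p)`. -/
theorem zip_convexOrder_zinb1 (p : ℝ) (hp₀ : 0 ≤ p) (hp₁ : p < 1)
    (θ t : ℝ) (hθ : 0 < θ) (ht : 0 < t) :
    ConvexOrder (ZIP θ p) (ZINB₁ t θ p) := by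
  exact (poisson_convexOrder_negBinomial (mul_pos ht (sub_pos.2 hp₁))
    (div_pos hθ (sub_pos.2 hp₁))).ziMeasure hp₁

end
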